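/- Let k be a field of characteristic zero and A a standard graded artinian k-algebra. Then the algebra A ⊗_k k[x₁,…,xₙ]/(x₁²,…,xₙ²) has the weak Lefschetz property for every integer n ≥ 0 (with n = 0 meaning A itself), if and only if A is almost centered and has the strong Lefschetz property. -/

import Mathlib

open scoped BigOperators

/-- Multiplication by `a` is injective as a map on the subspace `V`. -/
def MulInjOn {k R : Type*} [Field k] [CommRing R] [Algebra k R]
    (V : Submodule k R) (a : R) : Prop :=
  ∀ v ∈ V, a * v = 0 → v = 0

/-- Multiplication by `a` maps the subspace `V` onto the subspace `W`. -/
def MulSurjOnto {k R : Type*} [Field k] [CommRing R] [Algebra k R]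
    (V W : Submodule k R) (a : R) : Prop :=
  ∀ w ∈ W, ∃ v ∈ V, a * v = w

/-- The multiplication map `·a : V → W` has full rank: it is injective or surjective. -/
def MulFullRank {k R : Type*} [Field k] [CommRing R] [Algebra k R]
    (V W : Submodule k R) (a : R) : Prop :=
  MulInjOn V a ∨ MulSurjOnto V W a

/-- `𝒜` is the grading of a standard graded artinian `k`-algebra structure on `R`:
the components form an internal direct sum, vanish in negative degrees, are
multiplicative, the degree-zero part is spanned by `1`, the algebra is generated in
degree one, and `R` is a finite-dimensional `k`-vector space (equivalently, artinian). -/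
structure IsStdGradedArtinian (k : Type*) [Field k] (R : Type*) [CommRing R] [Algebra k R]
    (𝒜 : ℤ → Submodule k R) : Prop where
  internal : DirectSum.IsInternal 𝒜
  one_mem : (1 : R) ∈ 𝒜 0
  mul_mem : ∀ {i j : ℤ} {a b : R}, a ∈ 𝒜 i → b ∈ 𝒜 j → a * b ∈ 𝒜 (i + j)
  neg_bot : ∀ i : ℤ, i < 0 → 𝒜 i = ⊥
  zero_spanOne : 𝒜 0 = Submodule.span k {(1 : R)}
  succ_eq : ∀ i : ℤ, 0 ≤ i → 𝒜 (i + 1) = 𝒜 1 * 𝒜 i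
  finiteDim : FiniteDimensional k R

/-- `A` (graded by `ℬ`) is the extension `B ⊗ₖ k[x]/(x^d)` of `B` (graded by `𝒜`):
`φ` is the canonical inclusion of `B`, `x` has degree one with `x^d = 0`, and each
graded component decomposes as `ℬ j = ⊕_{q=0}^{d-1} x^q · φ(𝒜 (j - q))`. -/
structure IsCIExtension {k B A : Type*} [Field k] [CommRing B] [Algebra k B]
    [CommRing A] [Algebra k A]
    (𝒜 : ℤ → Submodule k B) (ℬ : ℤ → Submodule k A)
    (φ : B →ₐ[k] A) (x : A) (d : ℕ) : Prop where
  map_mem : ∀ (j : ℤ) (b : B), b ∈ 𝒜 j → φ b ∈ ℬ j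
  x_mem : x ∈ ℬ 1
  x_pow : x ^ d = 0
  decomp_mem : ∀ (j : ℤ) (f : Fin d → B), (∀ q : Fin d, f q ∈ 𝒜 (j - ((q : ℕ) : ℤ))) →
    (∑ q : Fin d, x ^ (q : ℕ) * φ (f q)) ∈ ℬ j
  decomp_exists : ∀ (j : ℤ), ∀ c ∈ ℬ j, ∃ f : Fin d → B,
    (∀ q : Fin d, f q ∈ 𝒜 (j - ((q : ℕ) : ℤ))) ∧ c = ∑ q : Fin d, x ^ (q : ℕ) * φ (f q)
  decomp_unique : ∀ (j : ℤ) (f : Fin d → B), (∀ q : Fin d, f q ∈ 𝒜 (j - ((q : ℕ) : ℤ))) →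
    (∑ q : Fin d, x ^ (q : ℕ) * φ (f q)) = 0 → ∀ q : Fin d, f q = 0

/-- `A` (graded by `ℬ`) is the extension `B ⊗ₖ k[x₁,…,xₙ]/(x₁^{d₁},…,xₙ^{dₙ})` of `B`
(graded by `𝒜`). -/
structure IsMultiCIExtension {k B A : Type*} [Field k] [CommRing B] [Algebra k B]
    [CommRing A] [Algebra k A] {n : ℕ}
    (𝒜 : ℤ → Submodule k B) (ℬ : ℤ → Submodule k A)
    (φ : B →ₐ[k] A) (x : Fin n → A) (dv : Fin n → ℕ) : Prop where
  map_mem : ∀ (j : ℤ) (b : B), b ∈ 𝒜 j → φ b ∈ ℬ j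
  x_mem : ∀ m : Fin n, x m ∈ ℬ 1
  x_pow : ∀ m : Fin n, x m ^ dv m = 0
  decomp_mem : ∀ (j : ℤ) (f : ((m : Fin n) → Fin (dv m)) → B),
    (∀ e, f e ∈ 𝒜 (j - ∑ m : Fin n, ((e m : ℕ) : ℤ))) →
    (∑ e : (m : Fin n) → Fin (dv m), (∏ m : Fin n, x m ^ ((e m : ℕ))) * φ (f e)) ∈ ℬ j
  decomp_exists : ∀ (j : ℤ), ∀ c ∈ ℬ j, ∃ f : ((m : Fin n) → Fin (dv m)) → B,
    (∀ e, f e ∈ 𝒜 (j - ∑ m : Fin n, ((e m : ℕ) : ℤ))) ∧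
    c = ∑ e : (m : Fin n) → Fin (dv m), (∏ m : Fin n, x m ^ ((e m : ℕ))) * φ (f e)
  decomp_unique : ∀ (j : ℤ) (f : ((m : Fin n) → Fin (dv m)) → B),
    (∀ e, f e ∈ 𝒜 (j - ∑ m : Fin n, ((e m : ℕ) : ℤ))) →
    (∑ e : (m : Fin n) → Fin (dv m), (∏ m : Fin n, x m ^ ((e m : ℕ))) * φ (f e)) = 0 →
    ∀ e, f e = 0

/-- The weak Lefschetz property. -/
def HasWLP {k R : Type*} [Field k] [CommRing R] [Algebra k R]
    (𝒜 : ℤ → Submodule k R) : Prop :=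
  ∃ ℓ ∈ 𝒜 1, ∀ i : ℤ, 0 ≤ i → MulFullRank (𝒜 i) (𝒜 (i + 1)) ℓ

/-- The strong Lefschetz property. -/
def HasSLP {k R : Type*} [Field k] [CommRing R] [Algebra k R]
    (𝒜 : ℤ → Submodule k R) : Prop :=
  ∃ ℓ ∈ 𝒜 1, ∀ i : ℤ, 0 ≤ i → ∀ t : ℕ, 1 ≤ t → MulFullRank (𝒜 i) (𝒜 (i + t)) (ℓ ^ t)

/-- The Hilbert function of the graded algebra. -/
noncomputable def hilb {k R : Type*} [Field k] [CommRing R] [Algebra k R]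
    (𝒜 : ℤ → Submodule k R) (i : ℤ) : ℕ :=
  Module.finrank k (𝒜 i)

/-- The algebra is almost centered. -/
def AlmostCentered {k R : Type*} [Field k] [CommRing R] [Algebra k R]
    (𝒜 : ℤ → Submodule k R) : Prop :=
  ∀ i j : ℤ, i < j →
    (hilb 𝒜 i < hilb 𝒜 j → ∀ s : ℕ, hilb 𝒜 (i - s) ≤ hilb 𝒜 (j + s)) ∧
    (hilb 𝒜 j < hilb 𝒜 i → ∀ s : ℕ, hilb 𝒜 (j + s) ≤ hilb 𝒜 (i - s))

/-- `binomZ t j` is the binomial coefficient `t` choose `j` for an integer `j`,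
equal to `0` for `j < 0` or `j > t`. -/
def binomZ (t : ℕ) (j : ℤ) : ℤ := if 0 ≤ j then (t.choose j.toNat : ℤ) else 0

/-- The `(d-p) × (d-p)` integer matrix `C_{t,p,d}` whose `(r,c)` entry (with `1 ≤ r,c ≤ d-p`)
is `binom(t, d+1-r-c)`. -/
def Cmat (t p d : ℕ) : Matrix (Fin (d - p)) (Fin (d - p)) ℤ :=
  Matrix.of fun r c => binomZ t ((d : ℤ) - 1 - (r : ℕ) - (c : ℕ))

/-- The characteristic of `k` is zero, or a prime not dividing the integer `N`. -/
def CharCond (k : Type*) [Field k] (N : ℤ) : Prop :=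
  CharZero k ∨ ∃ p : ℕ, p.Prime ∧ CharP k p ∧ ¬ ((p : ℤ) ∣ N)

open TrivSqZeroExt in
/-- The grading of the dual numbers `A[ε]` over a graded algebra in which `ε` has degree one. -/
def dualGrading {k A : Type*} [Field k] [CommRing A] [Algebra k A]
    (ℬ : ℤ → Submodule k A) (j : ℤ) : Submodule k (DualNumber A) where
  carrier := {z | z.fst ∈ ℬ j ∧ z.snd ∈ ℬ (j - 1)}
  add_mem' h h' := ⟨add_mem h.1 h'.1, add_mem h.2 h'.2⟩
  zero_mem' := ⟨zero_mem _, zero_mem _⟩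
  smul_mem' c _ h := ⟨Submodule.smul_mem _ c h.1, Submodule.smul_mem _ c h.2⟩

/-- Multiplication by powers of `ℓ` between degrees with sum at most `c` is injective, and
multiplication by powers of `ℓ` between degrees with sum greater than `c` is surjective. -/
def IsCenteredLefschetz {k R : Type*} [Field k] [CommRing R] [Algebra k R]
    (𝒜 : ℤ → Submodule k R) (ℓ : R) (c : ℤ) : Prop :=
  ∀ (i : ℤ) (r : ℕ), (2 * i + r ≤ c → MulInjOn (𝒜 i) (ℓ ^ r)) ∧
    (c < 2 * i + r → MulSurjOnto (𝒜 i) (𝒜 (i + r)) (ℓ ^ r))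

/-- Multiplication by `ℓ ^ r` is injective between degrees with sum `σ`, for all exponents
`1 ≤ r ≤ N` of the same parity as `N`. -/
def InjUpTo {k R : Type*} [Field k] [CommRing R] [Algebra k R]
    (𝒜 : ℤ → Submodule k R) (ℓ : R) (σ : ℤ) (N : ℕ) : Prop :=
  ∀ (i : ℤ) (r : ℕ), 1 ≤ r → r ≤ N → r % 2 = N % 2 → 2 * i + r = σ → MulInjOn (𝒜 i) (ℓ ^ r)

/-- Multiplication by `ℓ ^ r` is surjective between degrees with sum `σ`, for all exponents
`1 ≤ r ≤ N` of the same parity as `N`. -/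
def SurjUpTo {k R : Type*} [Field k] [CommRing R] [Algebra k R]
    (𝒜 : ℤ → Submodule k R) (ℓ : R) (σ : ℤ) (N : ℕ) : Prop :=
  ∀ (i : ℤ) (r : ℕ), 1 ≤ r → r ≤ N → r % 2 = N % 2 → 2 * i + r = σ →
    MulSurjOnto (𝒜 i) (𝒜 (i + r)) (ℓ ^ r)

section Pencil

variable {k : Type*} [Field k]

theorem finite_not_injective_one_add_smul {M : Type*} [AddCommGroup M] [Module k M]
    [FiniteDimensional k M] (G : Module.End k M) (t₀ : k) :
    {t : k | ¬ Function.Injective ((LinearMap.id : M →ₗ[k] M) + (t - t₀) • G)}.Finite := by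
  have hfin : {μ : k | G.HasEigenvalue μ}.Finite := Module.End.finite_hasEigenvalue G
  refine (hfin.preimage (f := fun t : k => -(t - t₀)⁻¹) ?_).subset ?_
  · intro t _ t' _ h
    simpa using h
  · intro t ht
    simp only [Set.mem_ofPred_eq, Set.mem_preimage] at ht ⊢
    rw [injective_iff_map_eq_zero] at ht
    push Not at ht
    obtain ⟨v, hv, hv0⟩ := ht
    have hv' : v + (t - t₀) • G v = 0 := by simpa using hv
    have hs : t - t₀ ≠ 0 := by
      intro hs
      rw [hs, zero_smul, add_zero] at hv'
      exact hv0 hv'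
    refine Module.End.hasEigenvalue_of_hasEigenvector (x := v) ⟨?_, hv0⟩
    rw [Module.End.mem_eigenspace_iff, eq_comm, neg_smul, neg_eq_iff_add_eq_zero,
      ← smul_right_injective M hs |>.eq_iff, smul_add, smul_smul, mul_inv_cancel₀ hs, one_smul,
      smul_zero, hv']

theorem finite_not_injective_add_smul {M N : Type*} [AddCommGroup M] [Module k M]
    [FiniteDimensional k M] [AddCommGroup N] [Module k N] (P Q : M →ₗ[k] N) {t₀ : k}
    (h : Function.Injective (P + t₀ • Q)) :
    {t : k | ¬ Function.Injective (P + t • Q)}.Finite := by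
  obtain ⟨L, hL⟩ := LinearMap.exists_leftInverse_of_injective _ (LinearMap.ker_eq_bot.2 h)
  refine (finite_not_injective_one_add_smul (L ∘ₗ Q) t₀).subset fun t ht hinj => ht ?_
  have : L ∘ₗ (P + t • Q) = LinearMap.id + (t - t₀) • (L ∘ₗ Q) := by
    rw [← hL, ← LinearMap.comp_smul, ← LinearMap.comp_add]
    congr 1
    module
  rw [← this, LinearMap.coe_comp] at hinj
  exact hinj.of_comp

theorem finite_not_surjective_add_smul {M N : Type*} [AddCommGroup M] [Module k M]
    [AddCommGroup N] [Module k N] [FiniteDimensional k N] (P Q : M →ₗ[k] N) {t₀ : k}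
    (h : Function.Surjective (P + t₀ • Q)) :
    {t : k | ¬ Function.Surjective (P + t • Q)}.Finite := by
  obtain ⟨L, hL⟩ := LinearMap.exists_rightInverse_of_surjective _ (LinearMap.range_eq_top.2 h)
  refine (finite_not_injective_one_add_smul (Q ∘ₗ L) t₀).subset fun t ht hinj => ht ?_
  have : (P + t • Q) ∘ₗ L = LinearMap.id + (t - t₀) • (Q ∘ₗ L) := by
    rw [← hL, ← LinearMap.smul_comp, ← LinearMap.add_comp]
    congr 1
    module
  rw [← this] at hinj
  have hsurj := LinearMap.injective_iff_surjective.1 hinj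
  rw [LinearMap.coe_comp] at hsurj
  exact hsurj.of_comp

theorem finite_not_mulFullRank {R : Type*} [CommRing R] [Algebra k R] [FiniteDimensional k R]
    {V W : Submodule k R} {a b : R} (ha : ∀ v ∈ V, a * v ∈ W) (hb : ∀ v ∈ V, b * v ∈ W) {t₀ : k}
    (h : MulFullRank V W (a + t₀ • b)) : {t : k | ¬ MulFullRank V W (a + t • b)}.Finite := by
  let P : V →ₗ[k] W := (LinearMap.mulLeft k a).restrict ha
  let Q : V →ₗ[k] W := (LinearMap.mulLeft k b).restrict hb
  have hPQ (t : k) (v : V) : (((P + t • Q) v : W) : R) = (a + t • b) * v := by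
    rw [add_mul, smul_mul_assoc]
    rfl
  have hinj (t : k) : MulInjOn V (a + t • b) ↔ Function.Injective (P + t • Q) := by
    rw [injective_iff_map_eq_zero]
    constructor
    · intro h v hv
      exact Subtype.ext (h v v.2 (by rw [← hPQ, hv]; rfl))
    · intro h v hv h0
      exact congrArg Subtype.val (h ⟨v, hv⟩ (Subtype.ext (by rw [hPQ]; exact h0)))
  have hsurj (t : k) : MulSurjOnto V W (a + t • b) ↔ Function.Surjective (P + t • Q) := by
    constructor
    · intro h w
      obtain ⟨v, hv, hvw⟩ := h w w.2
      exact ⟨⟨v, hv⟩, Subtype.ext (by rw [hPQ]; exact hvw)⟩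
    · intro h w hw
      obtain ⟨v, hv⟩ := h ⟨w, hw⟩
      exact ⟨v, v.2, by rw [← hPQ, hv]⟩
  rcases h with h | h
  · refine (finite_not_injective_add_smul P Q ((hinj t₀).1 h)).subset fun t ht hi => ht ?_
    exact Or.inl ((hinj t).2 hi)
  · refine (finite_not_surjective_add_smul P Q ((hsurj t₀).1 h)).subset fun t ht hi => ht ?_
    exact Or.inr ((hsurj t).2 hi)

end Pencil

section Graded

variable {k R : Type*} [Field k] [CommRing R] [Algebra k R] {𝒜 : ℤ → Submodule k R}

theorem IsStdGradedArtinian.exists_bound (h : IsStdGradedArtinian k R 𝒜) :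
    ∃ D : ℕ, ∀ j : ℤ, D ≤ j → 𝒜 j = ⊥ := by
  have := h.finiteDim
  have hind := h.internal.submodule_iSupIndep
  have hfin : {i | 𝒜 i ≠ ⊥}.Finite := WellFoundedGT.finite_ne_bot_of_iSupIndep hind
  obtain ⟨D, hD⟩ := hfin.bddAbove
  refine ⟨(D + 1).toNat, fun j hj => ?_⟩
  by_contra hne
  have := hD hne
  omega

theorem IsStdGradedArtinian.pow_mem (h : IsStdGradedArtinian k R 𝒜) {a : R} (ha : a ∈ 𝒜 1)
    (r : ℕ) : a ^ r ∈ 𝒜 r := by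
  induction r with
  | zero => simpa using h.one_mem
  | succ r ih =>
    rw [pow_succ]
    exact_mod_cast h.mul_mem ih ha

theorem IsStdGradedArtinian.pow_mul_mem (h : IsStdGradedArtinian k R 𝒜) {a v : R} {i : ℤ}
    (ha : a ∈ 𝒜 1) (r : ℕ) (hv : v ∈ 𝒜 i) : a ^ r * v ∈ 𝒜 (i + r) := by
  rw [add_comm]
  exact h.mul_mem (h.pow_mem ha r) hv

theorem IsStdGradedArtinian.finite_not_weakLefschetz (h : IsStdGradedArtinian k R 𝒜) {a b : R}
    (ha : a ∈ 𝒜 1) (hb : b ∈ 𝒜 1) {t₀ : k}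
    (h₀ : ∀ i : ℤ, 0 ≤ i → MulFullRank (𝒜 i) (𝒜 (i + 1)) (a + t₀ • b)) :
    {t : k | ¬ ∀ i : ℤ, 0 ≤ i → MulFullRank (𝒜 i) (𝒜 (i + 1)) (a + t • b)}.Finite := by
  have := h.finiteDim
  obtain ⟨D, hD⟩ := h.exists_bound
  have hmul {c : R} (hc : c ∈ 𝒜 1) (i : ℤ) : ∀ v ∈ 𝒜 i, c * v ∈ 𝒜 (i + 1) := fun v hv => by
    rw [add_comm]; exact h.mul_mem hc hv
  refine ((Set.finite_Ico (0 : ℤ) D).biUnion fun i hi =>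
    finite_not_mulFullRank (hmul ha i) (hmul hb i) (h₀ i hi.1)).subset fun t ht => ?_
  simp only [Set.mem_ofPred_eq, not_forall] at ht
  obtain ⟨i, hi, hit⟩ := ht
  refine Set.mem_biUnion (x := i) ⟨hi, ?_⟩ hit
  by_contra hiD
  refine hit (Or.inl fun v hv _ => ?_)
  rw [hD i (not_lt.1 hiD)] at hv
  simpa using hv

end Graded

section Dual

open TrivSqZeroExt

variable {k A : Type*} [Field k] [CommRing A] [Algebra k A] {ℬ : ℤ → Submodule k A}

theorem inl_mem_dualGrading {j : ℤ} {a : A} (ha : a ∈ ℬ j) :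
    (inl a : DualNumber A) ∈ dualGrading ℬ j :=
  ⟨ha, zero_mem _⟩

theorem inr_mem_dualGrading {j : ℤ} {a : A} (ha : a ∈ ℬ (j - 1)) :
    (inr a : DualNumber A) ∈ dualGrading ℬ j :=
  ⟨zero_mem _, ha⟩

theorem IsStdGradedArtinian.iSupIndep_dualGrading (h : IsStdGradedArtinian k A ℬ) :
    iSupIndep (dualGrading ℬ) := by
  have hind := h.internal.submodule_iSupIndep
  rw [iSupIndep_iff_finsetSum_eq_zero_imp_eq_zero] at hind ⊢
  intro s v hv hs i hi
  have hfst := hind s (fun i => (v i).fst) (fun i hi => (hv i hi).1)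
    (by rw [← fst_sum, hs, fst_zero]) i hi
  have hind' := h.internal.submodule_iSupIndep.comp (sub_left_injective (b := (1 : ℤ)))
  rw [iSupIndep_iff_finsetSum_eq_zero_imp_eq_zero] at hind'
  have hsnd := hind' s (fun i => (v i).snd) (fun i hi => (hv i hi).2)
    (by rw [← snd_sum, hs, snd_zero]) i hi
  exact TrivSqZeroExt.ext hfst hsnd

theorem IsStdGradedArtinian.iSup_dualGrading (h : IsStdGradedArtinian k A ℬ) :
    iSup (dualGrading ℬ) = ⊤ := by
  have htop := h.internal.submodule_iSup_eq_top
  rw [eq_top_iff]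
  rintro z -
  rw [← inl_fst_add_inr_snd_eq z]
  refine add_mem ?_ ?_
  · have hz : z.fst ∈ iSup ℬ := htop ▸ Submodule.mem_top
    generalize z.fst = x at hz ⊢
    induction hz using Submodule.iSup_induction' with
    | mem i a ha => exact Submodule.mem_iSup_of_mem i (inl_mem_dualGrading ha)
    | zero => rw [inl_zero]; exact zero_mem _
    | add a b _ _ ha hb => rw [inl_add]; exact add_mem ha hb
  · have hz : z.snd ∈ iSup ℬ := htop ▸ Submodule.mem_top
    generalize z.snd = x at hz ⊢
    induction hz using Submodule.iSup_induction' with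
    | mem i a ha =>
      exact Submodule.mem_iSup_of_mem (i + 1) (inr_mem_dualGrading (by simpa using ha))
    | zero => rw [inr_zero]; exact zero_mem _
    | add a b _ _ ha hb => rw [inr_add]; exact add_mem ha hb

theorem IsStdGradedArtinian.mul_mem_dualGrading (h : IsStdGradedArtinian k A ℬ) {i j : ℤ}
    {y z : DualNumber A} (hy : y ∈ dualGrading ℬ i) (hz : z ∈ dualGrading ℬ j) :
    y * z ∈ dualGrading ℬ (i + j) := by
  refine ⟨h.mul_mem hy.1 hz.1, ?_⟩
  rw [DualNumber.snd_mul]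
  refine add_mem ?_ ?_
  · rw [add_sub_assoc]; exact h.mul_mem hy.1 hz.2
  · rw [add_sub_right_comm]; exact h.mul_mem hy.2 hz.1

theorem IsStdGradedArtinian.dualGrading_succ (h : IsStdGradedArtinian k A ℬ) {i : ℤ} (hi : 0 ≤ i) :
    dualGrading ℬ (i + 1) = dualGrading ℬ 1 * dualGrading ℬ i := by
  refine le_antisymm ?_ (Submodule.mul_le.2 fun y hy z hz => ?_)
  · intro z hz
    rw [← inl_fst_add_inr_snd_eq z]
    refine add_mem ?_ ?_
    · have hz1 := hz.1
      rw [h.succ_eq i hi] at hz1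
      generalize z.fst = x at hz1 ⊢
      induction hz1 using Submodule.mul_induction_on' with
      | mem_mul_mem a ha b hb =>
        rw [inl_mul]
        exact Submodule.mul_mem_mul (inl_mem_dualGrading ha) (inl_mem_dualGrading hb)
      | add a _ b _ ha hb => rw [inl_add]; exact add_mem ha hb
    · have : (inr z.snd : DualNumber A) = inr 1 * inl z.snd := by
        rw [inr_mul_inl]; simp
      rw [this]
      refine Submodule.mul_mem_mul (inr_mem_dualGrading (by simpa using h.one_mem))
        (inl_mem_dualGrading ?_)
      simpa using hz.2
  · rw [add_comm]; exact h.mul_mem_dualGrading hy hz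

theorem IsStdGradedArtinian.dualNumber (h : IsStdGradedArtinian k A ℬ) :
    IsStdGradedArtinian k (DualNumber A) (dualGrading ℬ) where
  internal := (DirectSum.isInternal_submodule_iff_iSupIndep_and_iSup_eq_top _).2
    ⟨h.iSupIndep_dualGrading, h.iSup_dualGrading⟩
  one_mem := inl_mem_dualGrading h.one_mem
  mul_mem := h.mul_mem_dualGrading
  neg_bot i hi := by
    refine (Submodule.eq_bot_iff _).2 fun z hz => TrivSqZeroExt.ext ?_ ?_
    · simpa [h.neg_bot i hi] using hz.1
    · simpa [h.neg_bot (i - 1) (by omega)] using hz.2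
  zero_spanOne := by
    refine le_antisymm (fun z hz => ?_) ((Submodule.span_singleton_le_iff_mem _ _).2
      (inl_mem_dualGrading h.one_mem))
    have hz1 := hz.1
    rw [h.zero_spanOne, Submodule.mem_span_singleton] at hz1
    obtain ⟨c, hc⟩ := hz1
    refine Submodule.mem_span_singleton.2 ⟨c, TrivSqZeroExt.ext (by simpa using hc) ?_⟩
    have hz2 := hz.2
    rw [h.neg_bot _ (by norm_num), Submodule.mem_bot] at hz2
    simp [hz2]
  succ_eq _ hi := h.dualGrading_succ hi
  finiteDim := by
    have := h.finiteDim
    exact inferInstanceAs (FiniteDimensional k (A × A))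

theorem pow_mul_fst (a : A) (c : k) (r : ℕ) (z : DualNumber A) :
    ((inl a + inr (algebraMap k A c) : DualNumber A) ^ r * z).fst = a ^ r * z.fst := by
  simp

theorem pow_mul_snd (a : A) (c : k) (r : ℕ) (z : DualNumber A) :
    ((inl a + inr (algebraMap k A c) : DualNumber A) ^ (r + 1) * z).snd =
      a ^ (r + 1) * z.snd + ((r + 1 : k) * c) • (a ^ r * z.fst) := by
  simp only [DualNumber.snd_mul, fst_pow, snd_pow, fst_add, snd_add, fst_inl, fst_inr, snd_inl,
    snd_inr, add_zero, zero_add, Nat.pred_succ, nsmul_eq_mul, smul_eq_mul, Nat.cast_add,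
    Nat.cast_one]
  simp only [Algebra.smul_def, map_mul, map_add, map_natCast, map_one]
  ring

theorem mulInjOn_pow_of_dual {a : A} {c : k} {i : ℤ} {r : ℕ}
    (H : MulInjOn (dualGrading ℬ i) ((inl a + inr (algebraMap k A c)) ^ (r + 1))) :
    MulInjOn (ℬ i) (a ^ r) := by
  intro v hv h0
  have hz := H (inl v) (inl_mem_dualGrading hv) ?_
  · simpa using congrArg fst hz
  · refine TrivSqZeroExt.ext ?_ ?_
    · rw [pow_mul_fst, fst_inl, pow_succ', mul_assoc, h0, mul_zero, fst_zero]
    · rw [pow_mul_snd, fst_inl, h0, snd_inl, mul_zero, smul_zero, add_zero, snd_zero]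

theorem IsStdGradedArtinian.mulSurjOnto_pow_of_dual (h : IsStdGradedArtinian k A ℬ) {a : A}
    (ha : a ∈ ℬ 1) {c : k} {i j : ℤ} {r : ℕ}
    (H : MulSurjOnto (dualGrading ℬ i) (dualGrading ℬ j)
      ((inl a + inr (algebraMap k A c)) ^ (r + 1))) :
    MulSurjOnto (ℬ i) (ℬ (j - 1)) (a ^ r) := by
  intro q hq
  obtain ⟨z, hz, hzq⟩ := H _ (inr_mem_dualGrading hq)
  have h2 := congrArg snd hzq
  rw [pow_mul_snd, snd_inr] at h2
  refine ⟨a * z.snd + ((r + 1 : k) * c) • z.fst, add_mem ?_ (Submodule.smul_mem _ _ hz.1), ?_⟩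
  · simpa using h.pow_mul_mem ha 1 hz.2
  · rw [mul_add, ← mul_assoc, ← pow_succ, mul_smul_comm, h2]

variable [CharZero k]

theorem natCast_add_one_mul_ne_zero {c : k} (hc : c ≠ 0) (r : ℕ) : (r + 1 : k) * c ≠ 0 :=
  mul_ne_zero (Nat.cast_add_one_ne_zero r) hc

theorem IsStdGradedArtinian.mulInjOn_pow_add_two (h : IsStdGradedArtinian k A ℬ) {a : A}
    (ha : a ∈ ℬ 1) {c : k} (hc : c ≠ 0) {i : ℤ} {r : ℕ}
    (H : MulInjOn (dualGrading ℬ i) ((inl a + inr (algebraMap k A c)) ^ (r + 1))) :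
    MulInjOn (ℬ (i - 1)) (a ^ (r + 2)) := by
  intro v hv h0
  have hz := H (inl (a * v) + inr (-(((r + 1 : k) * c) • v))) ⟨?_, ?_⟩ ?_
  · have := congrArg snd hz
    simpa [natCast_add_one_mul_ne_zero hc r, -mul_eq_zero] using this
  · simpa using h.pow_mul_mem ha 1 hv
  · simpa using Submodule.smul_mem _ _ hv
  · refine TrivSqZeroExt.ext ?_ ?_
    · rw [pow_mul_fst]
      simp only [fst_add, fst_inl, fst_inr, add_zero, fst_zero]
      rw [← mul_assoc, ← pow_succ, h0]
    · rw [pow_mul_snd]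
      simp only [fst_add, fst_inl, fst_inr, add_zero, snd_add, snd_inl, snd_inr, zero_add, snd_zero]
      rw [← mul_assoc, ← pow_succ, mul_neg, mul_smul_comm, neg_add_cancel]

theorem mulSurjOnto_pow_add_two {a : A} {c : k} (hc : c ≠ 0) {i j : ℤ} {r : ℕ}
    (H : MulSurjOnto (dualGrading ℬ i) (dualGrading ℬ j)
      ((inl a + inr (algebraMap k A c)) ^ (r + 1))) :
    MulSurjOnto (ℬ (i - 1)) (ℬ j) (a ^ (r + 2)) := by
  intro p hp
  obtain ⟨z, hz, hzp⟩ := H _ (inl_mem_dualGrading hp)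
  have h1 := congrArg fst hzp
  have h2 := congrArg snd hzp
  rw [pow_mul_fst, fst_inl] at h1
  rw [pow_mul_snd, snd_inl, add_comm, add_eq_zero_iff_eq_neg] at h2
  have hκ := natCast_add_one_mul_ne_zero hc r
  refine ⟨-(((r + 1 : k) * c)⁻¹ • z.snd), neg_mem (Submodule.smul_mem _ _ hz.2), ?_⟩
  rw [← h1, pow_succ', pow_succ' a r, mul_assoc, mul_neg, mul_smul_comm, ← smul_neg, ← pow_succ',
    ← h2, smul_smul, inv_mul_cancel₀ hκ, one_smul, ← mul_assoc, ← pow_succ']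

theorem IsStdGradedArtinian.injUpTo_of_dual (h : IsStdGradedArtinian k A ℬ) {a : A}
    (ha : a ∈ ℬ 1) {c : k} (hc : c ≠ 0) {σ : ℤ} {N : ℕ} (hN : 1 ≤ N)
    (H : InjUpTo (dualGrading ℬ) (inl a + inr (algebraMap k A c)) (σ + 1) N) :
    InjUpTo ℬ a σ (N + 1) := by
  intro i r h1 hr hmod hσ
  obtain rfl | ⟨r, rfl⟩ : r = 1 ∨ ∃ s, r = s + 2 := by
    rcases r with _ | _ | r
    · omega
    · exact Or.inl rfl
    · exact Or.inr ⟨r, rfl⟩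
  · exact mulInjOn_pow_of_dual (H i 2 (by omega) (by omega) (by omega) (by push_cast at *; omega))
  · have := h.mulInjOn_pow_add_two ha hc
      (H (i + 1) (r + 1) (by omega) (by omega) (by omega) (by push_cast at *; omega))
    rwa [add_sub_cancel_right] at this

theorem IsStdGradedArtinian.surjUpTo_of_dual (h : IsStdGradedArtinian k A ℬ) {a : A}
    (ha : a ∈ ℬ 1) {c : k} (hc : c ≠ 0) {σ : ℤ} {N : ℕ} (hN : 1 ≤ N)
    (H : SurjUpTo (dualGrading ℬ) (inl a + inr (algebraMap k A c)) (σ + 1) N) :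
    SurjUpTo ℬ a σ (N + 1) := by
  intro i r h1 hr hmod hσ
  obtain rfl | ⟨r, rfl⟩ : r = 1 ∨ ∃ s, r = s + 2 := by
    rcases r with _ | _ | r
    · omega
    · exact Or.inl rfl
    · exact Or.inr ⟨r, rfl⟩
  · have := h.mulSurjOnto_pow_of_dual ha
      (H i 2 (by omega) (by omega) (by omega) (by push_cast at *; omega))
    convert this using 2
    push_cast; ring
  · have := mulSurjOnto_pow_add_two hc
      (H (i + 1) (r + 1) (by omega) (by omega) (by omega) (by push_cast at *; omega))
    rw [add_sub_cancel_right] at this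
    convert this using 2
    push_cast; ring

theorem IsCenteredLefschetz.dualNumber {a : A} {c : ℤ} (H : IsCenteredLefschetz ℬ a c)
    (h : IsStdGradedArtinian k A ℬ) (ha : a ∈ ℬ 1) :
    IsCenteredLefschetz (dualGrading ℬ) (inl a + inr (algebraMap k A 1)) (c + 1) := by
  intro i r
  rcases r with _ | r
  · exact ⟨fun _ v _ h0 => by simpa using h0, fun _ w hw => ⟨w, by simpa using hw, by simp⟩⟩
  have hκ := natCast_add_one_mul_ne_zero (one_ne_zero (α := k)) r
  constructor
  · intro hle z hz h0
    have h1 := congrArg fst h0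
    have h2 := congrArg snd h0
    rw [pow_mul_fst, fst_zero] at h1
    rw [pow_mul_snd, snd_zero] at h2
    have hsnd : z.snd = 0 := by
      refine (H (i - 1) (r + 2)).1 (by push_cast at *; omega) _ hz.2 ?_
      have h3 := congrArg (a * ·) h2
      simp only [mul_zero, mul_add, mul_smul_comm] at h3
      rwa [← mul_assoc, ← mul_assoc, ← pow_succ', ← pow_succ', h1, smul_zero, add_zero] at h3
    rw [hsnd, mul_zero, zero_add, smul_eq_zero_iff_right hκ] at h2
    exact TrivSqZeroExt.ext ((H i r).1 (by push_cast at *; omega) _ hz.1 h2) hsnd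
  · intro hlt w hw
    obtain ⟨v₀, hv₀, hv₀w⟩ := (H i r).2 (by push_cast at *; omega)
      (((r + 1 : k) * 1)⁻¹ • w.snd) (Submodule.smul_mem _ _ (by
        convert hw.2 using 2; push_cast; ring))
    obtain ⟨u, hu, huw⟩ := (H (i - 1) (r + 2)).2 (by push_cast at *; omega)
      (w.fst - a ^ (r + 1) * v₀) (by
        rw [show i - 1 + ((r + 2 : ℕ) : ℤ) = i + ((r + 1 : ℕ) : ℤ) by push_cast; ring]
        exact sub_mem hw.1 (h.pow_mul_mem ha _ hv₀))
    refine ⟨inl (v₀ + a * u) + inr (-(((r + 1 : k) * 1) • u)), ⟨?_, ?_⟩, TrivSqZeroExt.ext ?_ ?_⟩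
    · simpa using add_mem hv₀ (by simpa using h.pow_mul_mem ha 1 hu)
    · simpa using Submodule.smul_mem _ _ hu
    · rw [pow_mul_fst]
      simp only [fst_add, fst_inl, fst_inr, add_zero]
      rw [mul_add, ← mul_assoc, ← pow_succ, huw, add_sub_cancel]
    · rw [pow_mul_snd]
      simp only [fst_add, fst_inl, fst_inr, add_zero, snd_add, snd_inl, snd_inr, zero_add]
      rw [mul_add, hv₀w, smul_add, smul_smul, mul_inv_cancel₀ hκ, one_smul, ← mul_assoc,
        ← pow_succ, mul_neg, mul_smul_comm]
      abel

end Dual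

section Tower

open TrivSqZeroExt

variable {k B A : Type} [Field k] [CommRing B] [Algebra k B] [CommRing A] [Algebra k A]
  {𝒜 : ℤ → Submodule k B} {ℬ : ℤ → Submodule k A} {n : ℕ} {φ : B →ₐ[k] A} {x : Fin n → A}

theorem sum_cons_eq_inl_add_inr (φ : B →ₐ[k] A) (x : Fin n → A) (f : (Fin (n + 1) → Fin 2) → B) :
    ∑ e : Fin (n + 1) → Fin 2,
      (∏ m, (Fin.cons DualNumber.eps (fun i => inl (x i)) : Fin (n + 1) → DualNumber A) m ^
        (e m : ℕ)) * ((inlAlgHom k A A).comp φ) (f e) =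
    (inl (∑ e : Fin n → Fin 2, (∏ m, x m ^ (e m : ℕ)) * φ (f (Fin.cons 0 e))) : DualNumber A) +
      inr (∑ e : Fin n → Fin 2, (∏ m, x m ^ (e m : ℕ)) * φ (f (Fin.cons 1 e))) := by
  have hinl (a : A) : (inl a : DualNumber A) = inlHom A A a := rfl
  have hprod (e : Fin n → Fin 2) :
      ∏ m, (inl (x m) : DualNumber A) ^ (e m : ℕ) = inl (∏ m, x m ^ (e m : ℕ)) := by
    simp only [hinl, map_prod, map_pow]
  rw [← (Fin.consEquiv (fun _ => Fin 2)).sum_comp, Fintype.sum_prod_type, Fin.sum_univ_two]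
  congr 1
  · rw [hinl, map_sum]
    refine Finset.sum_congr rfl fun e _ => ?_
    simp only [Fin.consEquiv_apply, Fin.prod_univ_succ, Fin.cons_zero, Fin.cons_succ, hprod,
      AlgHom.comp_apply, inlAlgHom_apply, ← hinl, inl_mul]
    simp only [Fin.val_zero, pow_zero, one_mul]
    rfl
  · rw [← inrHom_apply, map_sum]
    refine Finset.sum_congr rfl fun e _ => ?_
    simp only [Fin.consEquiv_apply, Fin.prod_univ_succ, Fin.cons_zero, Fin.cons_succ, hprod,
      AlgHom.comp_apply, inlAlgHom_apply, inrHom_apply]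
    refine TrivSqZeroExt.ext (by simp) ?_
    simp
    rfl

theorem mem_cons_zero {f : (Fin (n + 1) → Fin 2) → B} {j : ℤ}
    (hf : ∀ e, f e ∈ 𝒜 (j - ∑ m, ((e m : ℕ) : ℤ))) (e : Fin n → Fin 2) :
    f (Fin.cons 0 e) ∈ 𝒜 (j - ∑ m, ((e m : ℕ) : ℤ)) := by
  simpa [Fin.sum_univ_succ] using hf (Fin.cons 0 e)

theorem mem_cons_one {f : (Fin (n + 1) → Fin 2) → B} {j : ℤ}
    (hf : ∀ e, f e ∈ 𝒜 (j - ∑ m, ((e m : ℕ) : ℤ))) (e : Fin n → Fin 2) :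
    f (Fin.cons 1 e) ∈ 𝒜 (j - 1 - ∑ m, ((e m : ℕ) : ℤ)) := by
  simpa [Fin.sum_univ_succ, sub_sub] using hf (Fin.cons 1 e)

theorem IsMultiCIExtension.dualNumber (h : IsMultiCIExtension 𝒜 ℬ φ x (fun _ => 2))
    (hℬ : IsStdGradedArtinian k A ℬ) :
    IsMultiCIExtension 𝒜 (dualGrading ℬ) ((inlAlgHom k A A).comp φ)
      (Fin.cons DualNumber.eps (fun i => inl (x i)) : Fin (n + 1) → DualNumber A)
      (fun _ => 2) where
  map_mem j b hb := inl_mem_dualGrading (h.map_mem j b hb)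
  x_mem m := by
    refine Fin.cases ?_ (fun i => ?_) m
    · exact inr_mem_dualGrading (by simpa using hℬ.one_mem)
    · exact inl_mem_dualGrading (h.x_mem i)
  x_pow m := by
    refine Fin.cases ?_ (fun i => ?_) m
    · simp
    · simp only [Fin.cons_succ]
      rw [inl_pow, h.x_pow i, inl_zero]
  decomp_mem j f hf := by
    rw [sum_cons_eq_inl_add_inr]
    exact add_mem
      (inl_mem_dualGrading (h.decomp_mem j (fun e => f (Fin.cons 0 e)) (mem_cons_zero hf)))
      (inr_mem_dualGrading (h.decomp_mem (j - 1) (fun e => f (Fin.cons 1 e)) (mem_cons_one hf)))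
  decomp_exists j z hz := by
    obtain ⟨f, hf, hfz⟩ := h.decomp_exists j _ hz.1
    obtain ⟨g, hg, hgz⟩ := h.decomp_exists (j - 1) _ hz.2
    refine ⟨fun e => if e 0 = 0 then f (Fin.tail e) else g (Fin.tail e), fun e => ?_, ?_⟩
    · refine Fin.consCases (fun q e => ?_) e
      simp only [Fin.cons_zero, Fin.tail_cons, Fin.sum_univ_succ, Fin.cons_succ]
      fin_cases q
      · simpa using hf e
      · simpa [sub_sub] using hg e
    · rw [sum_cons_eq_inl_add_inr]
      simp only [Fin.cons_zero, Fin.tail_cons, if_true, one_ne_zero, if_false]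
      exact (inl_fst_add_inr_snd_eq z).symm.trans (congrArg₂ (fun a b => inl a + inr b) hfz hgz)
  decomp_unique j f hf h0 := by
    rw [sum_cons_eq_inl_add_inr] at h0
    have h0₁ := h.decomp_unique j (fun e => f (Fin.cons 0 e)) (mem_cons_zero hf)
      (by simpa using congrArg fst h0)
    have h0₂ := h.decomp_unique (j - 1) (fun e => f (Fin.cons 1 e)) (mem_cons_one hf)
      (by simpa using congrArg snd h0)
    intro e
    refine Fin.consCases (fun q e => ?_) e
    fin_cases q
    · exact h0₁ e
    · exact h0₂ e

/-- A model of `B ⊗ k[x₁,…,xₙ]/(x₁²,…,xₙ²)`, together with its universal property and the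
transfer of Lefschetz properties between it and `B`. -/
structure IsSquareExtensionModel (𝒜 : ℤ → Submodule k B) (ℬ : ℤ → Submodule k A)
    (φ : B →ₐ[k] A) (x : Fin n → A) : Prop where
  std : IsStdGradedArtinian k A ℬ
  ext : IsMultiCIExtension 𝒜 ℬ φ x (fun _ => 2)
  degree_one : ∀ a ∈ ℬ 1, ∃ ℓ ∈ 𝒜 1, ∃ c : Fin n → k, a = φ ℓ + ∑ m, c m • x m
  exists_lift : ∀ (A' : Type) [CommRing A'] [Algebra k A'] (φ' : B →ₐ[k] A') (x' : Fin n → A'),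
    (∀ m, x' m ^ 2 = 0) → ∃ ψ : A →ₐ[k] A', (∀ b, ψ (φ b) = φ' b) ∧ ∀ m, ψ (x m) = x' m
  centered : ∀ ℓ ∈ 𝒜 1, ∀ c : ℤ, IsCenteredLefschetz 𝒜 ℓ c →
    IsCenteredLefschetz ℬ (φ ℓ + ∑ m, (1 : k) • x m) (c + n)
  injUpTo : ∀ ℓ ∈ 𝒜 1, ∀ c : Fin n → k, (∀ m, c m ≠ 0) → ∀ (σ : ℤ) (N : ℕ), 1 ≤ N →
    InjUpTo ℬ (φ ℓ + ∑ m, c m • x m) (σ + n) N → InjUpTo 𝒜 ℓ σ (N + n)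
  surjUpTo : ∀ ℓ ∈ 𝒜 1, ∀ c : Fin n → k, (∀ m, c m ≠ 0) → ∀ (σ : ℤ) (N : ℕ), 1 ≤ N →
    SurjUpTo ℬ (φ ℓ + ∑ m, c m • x m) (σ + n) N → SurjUpTo 𝒜 ℓ σ (N + n)

theorem IsMultiCIExtension.linear_mem (h : IsMultiCIExtension 𝒜 ℬ φ x (fun _ => 2)) {ℓ : B}
    (hℓ : ℓ ∈ 𝒜 1) (c : Fin n → k) : φ ℓ + ∑ m, c m • x m ∈ ℬ 1 :=
  add_mem (h.map_mem 1 ℓ hℓ) (sum_mem fun m _ => Submodule.smul_mem _ _ (h.x_mem m))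

theorem linear_cons (φ : B →ₐ[k] A) (x : Fin n → A) (ℓ : B) (c : Fin (n + 1) → k) :
    (inlAlgHom k A A).comp φ ℓ + ∑ m, c m •
      (Fin.cons DualNumber.eps (fun i => inl (x i)) : Fin (n + 1) → DualNumber A) m =
    inl (φ ℓ + ∑ m : Fin n, c m.succ • x m) + inr (algebraMap k A (c 0)) := by
  refine TrivSqZeroExt.ext ?_ ?_
  · simp [Fin.sum_univ_succ, fst_sum]
  · simp [Fin.sum_univ_succ, snd_sum, Algebra.algebraMap_eq_smul_one]

theorem IsStdGradedArtinian.isSquareExtensionModel_self (h : IsStdGradedArtinian k B 𝒜) :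
    IsSquareExtensionModel 𝒜 𝒜 (AlgHom.id k B) (Fin.elim0 : Fin 0 → B) where
  std := h
  ext :=
    { map_mem := fun _ _ hb => hb
      x_mem := fun m => m.elim0
      x_pow := fun m => m.elim0
      decomp_mem := fun j f hf => by
        rw [Fintype.sum_subsingleton _ (fun _ => 0)]
        simpa using hf fun _ => 0
      decomp_exists := fun j c hc => ⟨fun _ => c, fun e => by simpa using hc, by simp⟩
      decomp_unique := fun j f hf h0 e => by
        rw [Fintype.sum_subsingleton _ e] at h0
        simpa using h0 }
  degree_one a ha := ⟨a, ha, Fin.elim0, by simp⟩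
  exists_lift A' _ _ φ' x' _ := ⟨φ', fun _ => rfl, fun m => m.elim0⟩
  centered ℓ _ c hc := by simpa using hc
  injUpTo ℓ _ c _ σ N _ H := by simpa using H
  surjUpTo ℓ _ c _ σ N _ H := by simpa using H

theorem IsSquareExtensionModel.dualNumber [CharZero k] (h : IsSquareExtensionModel 𝒜 ℬ φ x) :
    IsSquareExtensionModel 𝒜 (dualGrading ℬ) ((inlAlgHom k A A).comp φ)
      (Fin.cons DualNumber.eps (fun i => inl (x i)) : Fin (n + 1) → DualNumber A) where
  std := h.std.dualNumber
  ext := h.ext.dualNumber h.std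
  degree_one a ha := by
    obtain ⟨ℓ, hℓ, c, hc⟩ := h.degree_one _ ha.1
    have ha2 := ha.2
    rw [sub_self, h.std.zero_spanOne, Submodule.mem_span_singleton] at ha2
    obtain ⟨q, hq⟩ := ha2
    refine ⟨ℓ, hℓ, Fin.cons q c, ?_⟩
    rw [linear_cons, ← inl_fst_add_inr_snd_eq a, hc, ← hq]
    simp [Algebra.algebraMap_eq_smul_one]
  exists_lift A' _ _ φ' x' hx' := by
    obtain ⟨ψ, hψφ, hψx⟩ := h.exists_lift A' φ' (fun i => x' i.succ) fun i => hx' _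
    refine ⟨DualNumber.lift ⟨(ψ, x' 0), by rw [← pow_two, hx'], fun _ => mul_comm _ _⟩,
      fun b => ?_, fun m => ?_⟩
    · simp [hψφ]
    · refine Fin.cases ?_ (fun i => ?_) m
      · simp
      · simp [hψx]
  centered ℓ hℓ c hc := by
    rw [linear_cons φ x ℓ (fun _ => 1), Nat.cast_succ, ← add_assoc]
    exact (h.centered ℓ hℓ c hc).dualNumber h.std (h.ext.linear_mem hℓ fun _ => 1)
  injUpTo ℓ hℓ c hc σ N hN H := by
    rw [linear_cons, Nat.cast_succ, ← add_assoc] at H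
    have := h.injUpTo ℓ hℓ _ (fun m => hc m.succ) σ (N + 1) (by omega)
      (h.std.injUpTo_of_dual (h.ext.linear_mem hℓ _) (hc 0) hN H)
    rwa [add_assoc, add_comm 1] at this
  surjUpTo ℓ hℓ c hc σ N hN H := by
    rw [linear_cons, Nat.cast_succ, ← add_assoc] at H
    have := h.surjUpTo ℓ hℓ _ (fun m => hc m.succ) σ (N + 1) (by omega)
      (h.std.surjUpTo_of_dual (h.ext.linear_mem hℓ _) (hc 0) hN H)
    rwa [add_assoc, add_comm 1] at this

theorem IsStdGradedArtinian.exists_isSquareExtensionModel [CharZero k]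
    (h : IsStdGradedArtinian k B 𝒜) (n : ℕ) :
    ∃ (A : Type) (_ : CommRing A) (_ : Algebra k A) (ℬ : ℤ → Submodule k A) (φ : B →ₐ[k] A)
      (x : Fin n → A), IsSquareExtensionModel 𝒜 ℬ φ x := by
  induction n with
  | zero => exact ⟨B, _, _, 𝒜, _, _, h.isSquareExtensionModel_self⟩
  | succ n ih =>
    obtain ⟨A, _, _, ℬ, φ, x, hA⟩ := ih
    exact ⟨DualNumber A, _, _, _, _, _, hA.dualNumber⟩

end Tower

section Hilbert

variable {k R : Type*} [Field k] [CommRing R] [Algebra k R]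

theorem MulInjOn.finrank_le [FiniteDimensional k R] {V W : Submodule k R} {a : R}
    (h : MulInjOn V a) (ha : ∀ v ∈ V, a * v ∈ W) : Module.finrank k V ≤ Module.finrank k W := by
  refine LinearMap.finrank_le_finrank_of_injective (f := (LinearMap.mulLeft k a).restrict ha) ?_
  rw [injective_iff_map_eq_zero]
  exact fun v hv => Subtype.ext (h v v.2 (congrArg Subtype.val hv))

theorem MulSurjOnto.finrank_le [FiniteDimensional k R] {V W : Submodule k R} {a : R}
    (h : MulSurjOnto V W a) (ha : ∀ v ∈ V, a * v ∈ W) :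
    Module.finrank k W ≤ Module.finrank k V := by
  refine LinearMap.finrank_le_finrank_of_surjective (f := (LinearMap.mulLeft k a).restrict ha) ?_
  intro w
  obtain ⟨v, hv, hvw⟩ := h w w.2
  exact ⟨⟨v, hv⟩, Subtype.ext hvw⟩

theorem mulInjOn_iff_mulSurjOnto [FiniteDimensional k R] {V W : Submodule k R} {a : R}
    (ha : ∀ v ∈ V, a * v ∈ W) (hVW : Module.finrank k V = Module.finrank k W) :
    MulInjOn V a ↔ MulSurjOnto V W a := by
  have key := LinearMap.injective_iff_surjective_of_finrank_eq_finrank hVW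
    (f := (LinearMap.mulLeft k a).restrict ha)
  rw [injective_iff_map_eq_zero] at key
  constructor
  · intro h w hw
    obtain ⟨v, hv⟩ := key.1 (fun v hv => Subtype.ext (h v v.2 (congrArg Subtype.val hv))) ⟨w, hw⟩
    exact ⟨v, v.2, congrArg Subtype.val hv⟩
  · intro h v hv h0
    refine congrArg Subtype.val (key.2 (fun w => ?_) ⟨v, hv⟩ (Subtype.ext h0))
    obtain ⟨v, hv, hvw⟩ := h w w.2
    exact ⟨⟨v, hv⟩, Subtype.ext hvw⟩

theorem MulFullRank.mulInjOn [FiniteDimensional k R] {V W : Submodule k R} {a : R}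
    (h : MulFullRank V W a) (ha : ∀ v ∈ V, a * v ∈ W)
    (hVW : Module.finrank k V ≤ Module.finrank k W) : MulInjOn V a :=
  h.elim id fun hs => (mulInjOn_iff_mulSurjOnto ha (hVW.antisymm (hs.finrank_le ha))).2 hs

theorem MulFullRank.mulSurjOnto [FiniteDimensional k R] {V W : Submodule k R} {a : R}
    (h : MulFullRank V W a) (ha : ∀ v ∈ V, a * v ∈ W)
    (hVW : Module.finrank k W ≤ Module.finrank k V) : MulSurjOnto V W a :=
  h.elim (fun hi => (mulInjOn_iff_mulSurjOnto ha ((hi.finrank_le ha).antisymm hVW)).1 hi) id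

variable {𝒜 : ℤ → Submodule k R}

theorem hilb_eq_zero {i : ℤ} (h : 𝒜 i = ⊥) : hilb 𝒜 i = 0 := by
  rw [hilb, h, finrank_bot]

theorem mulInjOn_of_eq_bot {i : ℤ} (h : 𝒜 i = ⊥) (a : R) : MulInjOn (𝒜 i) a := by
  intro v hv _
  rwa [h, Submodule.mem_bot] at hv

theorem mulSurjOnto_of_eq_bot {i j : ℤ} (h : 𝒜 j = ⊥) (a : R) : MulSurjOnto (𝒜 i) (𝒜 j) a := by
  intro w hw
  rw [h, Submodule.mem_bot] at hw
  exact ⟨0, zero_mem _, by rw [hw, mul_zero]⟩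

theorem IsStdGradedArtinian.mulSurjOnto_succ (h : IsStdGradedArtinian k R 𝒜) {ℓ : R} {p : ℤ}
    (hp : 0 ≤ p) (hs : MulSurjOnto (𝒜 p) (𝒜 (p + 1)) ℓ) :
    MulSurjOnto (𝒜 (p + 1)) (𝒜 (p + 1 + 1)) ℓ := by
  intro w hw
  rw [h.succ_eq (p + 1) (by omega)] at hw
  induction hw using Submodule.mul_induction_on' with
  | mem_mul_mem a ha b hb =>
    obtain ⟨v, hv, rfl⟩ := hs b hb
    exact ⟨a * v, by rw [add_comm]; exact h.mul_mem ha hv, by ring⟩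
  | add a _ b _ ha hb =>
    obtain ⟨v, hv, rfl⟩ := ha
    obtain ⟨u, hu, rfl⟩ := hb
    exact ⟨v + u, add_mem hv hu, mul_add _ _ _⟩

theorem IsStdGradedArtinian.hilb_succ_lt (h : IsStdGradedArtinian k R 𝒜) {ℓ : R} (hℓ : ℓ ∈ 𝒜 1)
    (hslp : ∀ i : ℤ, 0 ≤ i → ∀ t : ℕ, 1 ≤ t → MulFullRank (𝒜 i) (𝒜 (i + t)) (ℓ ^ t))
    {i j : ℤ} (hij : i < j) (hlt : hilb 𝒜 j < hilb 𝒜 i) : hilb 𝒜 (j + 1) < hilb 𝒜 i := by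
  have := h.finiteDim
  have hi : 0 ≤ i := by
    by_contra hi
    rw [hilb_eq_zero (h.neg_bot i (by omega))] at hlt
    omega
  obtain ⟨t, rfl⟩ : ∃ t : ℕ, j = i + (t + 1 : ℕ) :=
    ⟨(j - i - 1).toNat, by push_cast; omega⟩
  have hsurj := (hslp i hi (t + 1) (by omega)).mulSurjOnto
    (fun v hv => h.pow_mul_mem hℓ _ hv) hlt.le
  have hstep : MulSurjOnto (𝒜 (i + t)) (𝒜 (i + t + 1)) ℓ := by
    intro w hw
    obtain ⟨v, hv, rfl⟩ := hsurj w (by convert hw using 2; push_cast; ring)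
    exact ⟨ℓ ^ t * v, h.pow_mul_mem hℓ t hv, by ring⟩
  have hnext := h.mulSurjOnto_succ (by omega) hstep
  have hle : hilb 𝒜 (i + t + 1 + 1) ≤ hilb 𝒜 (i + t + 1) :=
    hnext.finrank_le fun v hv => by rw [add_comm _ (1 : ℤ)]; exact h.mul_mem hℓ hv
  refine lt_of_le_of_lt ?_ hlt
  rwa [Nat.cast_succ, ← add_assoc]

theorem IsStdGradedArtinian.exists_isCenteredLefschetz (h : IsStdGradedArtinian k R 𝒜)
    (hac : AlmostCentered 𝒜) (hslp : HasSLP 𝒜) : ∃ ℓ ∈ 𝒜 1, ∃ c, IsCenteredLefschetz 𝒜 ℓ c := by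
  have := h.finiteDim
  obtain ⟨ℓ, hℓ, hslp⟩ := hslp
  refine ⟨ℓ, hℓ, ?_⟩
  have hneg (i : ℤ) (hi : i < 0) : hilb 𝒜 i = 0 := hilb_eq_zero (h.neg_bot i hi)
  have hdesc {i j : ℤ} (hij : i < j) (hlt : hilb 𝒜 j < hilb 𝒜 i) (s : ℕ) :
      hilb 𝒜 (j + s) < hilb 𝒜 i := by
    induction s with
    | zero => simpa using hlt
    | succ s ih =>
      rw [Nat.cast_succ, ← add_assoc]
      exact h.hilb_succ_lt hℓ hslp (by omega) ih
  have hsep {i j i' j' : ℤ} (hij : i < j) (hlt : hilb 𝒜 i < hilb 𝒜 j) (hij' : i' < j')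
      (hlt' : hilb 𝒜 j' < hilb 𝒜 i') : i + j < i' + j' := by
    by_contra hle
    have hlt'' := hdesc hij' hlt' (i + j - i' - j').toNat
    rw [show j' + ((i + j - i' - j').toNat : ℤ) = i + j - i' by omega] at hlt''
    rcases le_total i' i with hi | hi
    · have := (hac i j hij).1 hlt (i - i').toNat
      rw [show i - ((i - i').toNat : ℤ) = i' by omega,
        show j + ((i - i').toNat : ℤ) = i + j - i' by omega] at this
      omega
    · have := (hac i' (i + j - i') (by omega)).2 hlt'' (i' - i).toNat
      rw [show i' - ((i' - i).toNat : ℤ) = i by omega,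
        show i + j - i' + ((i' - i).toNat : ℤ) = j by omega] at this
      omega
  obtain ⟨c, hcup, hcdown⟩ : ∃ c : ℤ,
      (∀ i j : ℤ, i < j → hilb 𝒜 i < hilb 𝒜 j → i + j ≤ c) ∧
      (∀ i j : ℤ, i < j → hilb 𝒜 j < hilb 𝒜 i → c < i + j) := by
    by_cases hU : ∃ σ : ℤ, ∃ i j : ℤ, i < j ∧ hilb 𝒜 i < hilb 𝒜 j ∧ i + j = σ
    · obtain ⟨D, hD⟩ := h.exists_bound
      obtain ⟨c, ⟨i, j, hij, hlt, rfl⟩, hmax⟩ := Int.exists_greatest_of_bdd (P := fun σ : ℤ =>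
        ∃ i j : ℤ, i < j ∧ hilb 𝒜 i < hilb 𝒜 j ∧ i + j = σ) ⟨2 * D, by
          rintro _ ⟨i, j, hij, hlt, rfl⟩
          by_contra hle
          rw [hilb_eq_zero (hD j (by omega))] at hlt
          omega⟩ hU
      exact ⟨i + j, fun i' j' hij' hlt' => hmax _ ⟨i', j', hij', hlt', rfl⟩,
        fun i' j' hij' hlt' => hsep hij hlt hij' hlt'⟩
    · refine ⟨0, fun i j hij hlt => (hU ⟨_, i, j, hij, hlt, rfl⟩).elim, fun i j hij hlt => ?_⟩
      have : 0 ≤ i := by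
        by_contra hi
        rw [hneg i (by omega)] at hlt
        omega
      omega
  refine ⟨c, fun i r => ?_⟩
  rcases r with _ | r
  · exact ⟨fun _ v _ h0 => by simpa using h0, fun _ w hw => ⟨w, by simpa using hw, by simp⟩⟩
  have hmul : ∀ v ∈ 𝒜 i, ℓ ^ (r + 1) * v ∈ 𝒜 (i + (r + 1 : ℕ)) :=
    fun v hv => h.pow_mul_mem hℓ _ hv
  constructor
  · intro hle
    rcases lt_or_ge i 0 with hi | hi
    · exact mulInjOn_of_eq_bot (h.neg_bot i hi) _
    · refine (hslp i hi (r + 1) (by omega)).mulInjOn hmul ?_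
      by_contra hlt
      have := hcdown i (i + (r + 1 : ℕ)) (by push_cast; omega) (not_le.1 hlt)
      omega
  · intro hlt
    have hle : hilb 𝒜 (i + (r + 1 : ℕ)) ≤ hilb 𝒜 i := by
      by_contra hlt'
      have := hcup i (i + (r + 1 : ℕ)) (by push_cast; omega) (not_le.1 hlt')
      omega
    rcases lt_or_ge i 0 with hi | hi
    · rw [hneg i hi, Nat.le_zero] at hle
      exact mulSurjOnto_of_eq_bot (Submodule.finrank_eq_zero.1 hle) _
    · exact (hslp i hi (r + 1) (by omega)).mulSurjOnto hmul hle

theorem IsCenteredLefschetz.hasSLP {ℓ : R} {c : ℤ} (H : IsCenteredLefschetz 𝒜 ℓ c)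
    (hℓ : ℓ ∈ 𝒜 1) : HasSLP 𝒜 :=
  ⟨ℓ, hℓ, fun i _ t _ => (le_or_gt (2 * i + t) c).imp (H i t).1 (H i t).2⟩

theorem IsCenteredLefschetz.almostCentered {ℓ : R} {c : ℤ} (H : IsCenteredLefschetz 𝒜 ℓ c)
    (h : IsStdGradedArtinian k R 𝒜) (hℓ : ℓ ∈ 𝒜 1) : AlmostCentered 𝒜 := by
  have := h.finiteDim
  have hle {i j : ℤ} (hij : i ≤ j) (hc : i + j ≤ c) : hilb 𝒜 i ≤ hilb 𝒜 j := by
    obtain ⟨r, rfl⟩ : ∃ r : ℕ, j = i + r := ⟨(j - i).toNat, by omega⟩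
    exact ((H i r).1 (by omega)).finrank_le fun v hv => h.pow_mul_mem hℓ _ hv
  have hge {i j : ℤ} (hij : i ≤ j) (hc : c < i + j) : hilb 𝒜 j ≤ hilb 𝒜 i := by
    obtain ⟨r, rfl⟩ : ∃ r : ℕ, j = i + r := ⟨(j - i).toNat, by omega⟩
    exact ((H i r).2 (by omega)).finrank_le fun v hv => h.pow_mul_mem hℓ _ hv
  refine fun i j hij => ⟨fun hlt s => ?_, fun hlt s => ?_⟩
  · refine hle (by omega) ?_
    by_contra hc
    exact hlt.not_ge (hge hij.le (by omega))
  · refine hge (by omega) ?_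
    by_contra hc
    exact hlt.not_ge (hle hij.le (by omega))

/-- If in every total degree multiplication by powers of `ℓ` is injective or surjective, then
the injective total degrees precede the surjective ones. -/
theorem IsStdGradedArtinian.exists_isCenteredLefschetz_of_forall (h : IsStdGradedArtinian k R 𝒜)
    {ℓ : R} (hℓ : ℓ ∈ 𝒜 1)
    (H : ∀ σ : ℤ, (∀ (i : ℤ) (r : ℕ), 2 * i + r = σ → MulInjOn (𝒜 i) (ℓ ^ r)) ∨
      (∀ (i : ℤ) (r : ℕ), 2 * i + r = σ → MulSurjOnto (𝒜 i) (𝒜 (i + r)) (ℓ ^ r))) :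
    ∃ c, IsCenteredLefschetz 𝒜 ℓ c := by
  obtain ⟨D, hD⟩ := h.exists_bound
  set J : ℤ → Prop := fun σ => ∀ (i : ℤ) (r : ℕ), 2 * i + r = σ → MulInjOn (𝒜 i) (ℓ ^ r)
  have hpred {σ : ℤ} (hσ : J (σ + 1)) : J σ := by
    intro i r hir v hv h0
    refine hσ i (r + 1) (by push_cast; omega) v hv ?_
    rw [pow_succ', mul_assoc, h0, mul_zero]
  have hdown {σ : ℤ} (hσ : J σ) (s : ℕ) : J (σ - s) := by
    induction s with
    | zero => simpa using hσ
    | succ s ih => exact hpred (by convert ih using 1; push_cast; ring)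
  by_cases hbot : 𝒜 0 = ⊥
  · have hzero : ∀ v : R, v = 0 := fun v => by
      have h1 := h.one_mem
      rw [hbot, Submodule.mem_bot] at h1
      rw [← one_mul v, h1, zero_mul]
    exact ⟨0, fun i r => ⟨fun _ v _ _ => hzero v,
      fun _ w _ => ⟨0, zero_mem _, by rw [hzero w, mul_zero]⟩⟩⟩
  obtain ⟨c, hc, hmax⟩ := Int.exists_greatest_of_bdd (P := J) ⟨D, fun σ hσ => by
      by_contra hlt
      refine hbot ((Submodule.eq_bot_iff _).2 fun v hv => hσ 0 σ.toNat (by omega) v hv ?_)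
      have := h.pow_mul_mem hℓ σ.toNat hv
      rwa [hD _ (by omega), Submodule.mem_bot] at this⟩
    ⟨-1, fun i r hir => mulInjOn_of_eq_bot (h.neg_bot i (by omega)) _⟩
  refine ⟨c, fun i r => ⟨fun hle => ?_, fun hlt => ?_⟩⟩
  · exact hdown hc (c - (2 * i + r)).toNat i r (by omega)
  · exact (H (2 * i + r)).resolve_left (fun hJ' => hlt.not_ge (hmax _ hJ')) i r rfl

end Hilbert

section Main

variable {k B A : Type} [Field k] [CommRing B] [Algebra k B] [CommRing A] [Algebra k A]
  {𝒜 : ℤ → Submodule k B} {ℬ : ℤ → Submodule k A} {n : ℕ} {φ : B →ₐ[k] A} {x : Fin n → A}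

theorem IsMultiCIExtension.hasWLP_of_algHom {dv : Fin n → ℕ}
    (h : IsMultiCIExtension 𝒜 ℬ φ x dv) (hℬ : IsStdGradedArtinian k A ℬ) {A' : Type}
    [CommRing A'] [Algebra k A'] {ℬ' : ℤ → Submodule k A'} {φ' : B →ₐ[k] A'} {x' : Fin n → A'}
    (h' : IsMultiCIExtension 𝒜 ℬ' φ' x' dv) (ψ : A →ₐ[k] A')
    (hψφ : ∀ b, ψ (φ b) = φ' b) (hψx : ∀ m, ψ (x m) = x' m) (hwlp : HasWLP ℬ) : HasWLP ℬ' := by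
  have hψ (f : ((m : Fin n) → Fin (dv m)) → B) :
      ψ (∑ e : (m : Fin n) → Fin (dv m), (∏ m : Fin n, x m ^ ((e m : ℕ))) * φ (f e)) =
      ∑ e : (m : Fin n) → Fin (dv m), (∏ m : Fin n, x' m ^ ((e m : ℕ))) * φ' (f e) := by
    simp only [map_sum, map_mul, map_prod, map_pow, hψφ, hψx]
  have hmem {j : ℤ} {z : A} (hz : z ∈ ℬ j) : ψ z ∈ ℬ' j := by
    obtain ⟨f, hf, rfl⟩ := h.decomp_exists j z hz
    rw [hψ]
    exact h'.decomp_mem j f hf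
  have hinj {j : ℤ} {z : A} (hz : z ∈ ℬ j) (h0 : ψ z = 0) : z = 0 := by
    obtain ⟨f, hf, rfl⟩ := h.decomp_exists j z hz
    rw [hψ] at h0
    simp [h'.decomp_unique j f hf h0]
  have hsurj {j : ℤ} {w : A'} (hw : w ∈ ℬ' j) : ∃ z ∈ ℬ j, ψ z = w := by
    obtain ⟨f, hf, rfl⟩ := h'.decomp_exists j w hw
    exact ⟨_, h.decomp_mem j f hf, hψ f⟩
  obtain ⟨ℓ, hℓ, hrank⟩ := hwlp
  refine ⟨ψ ℓ, hmem hℓ, fun i hi => (hrank i hi).imp (fun H w hw h0 => ?_) fun H w hw => ?_⟩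
  · obtain ⟨z, hz, rfl⟩ := hsurj hw
    have hz' : ℓ * z ∈ ℬ (i + 1) := by
      rw [add_comm]
      exact hℬ.mul_mem hℓ hz
    rw [H z hz (hinj hz' (by rw [map_mul, h0])), map_zero]
  · obtain ⟨z, hz, rfl⟩ := hsurj hw
    obtain ⟨v, hv, rfl⟩ := H z hz
    exact ⟨ψ v, hmem hv, (map_mul ψ _ _).symm⟩

theorem IsSquareExtensionModel.hasWLP (h : IsSquareExtensionModel 𝒜 ℬ φ x) {ℓ : B} (hℓ : ℓ ∈ 𝒜 1)
    {c : ℤ} (hc : IsCenteredLefschetz 𝒜 ℓ c) : HasWLP ℬ := by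
  refine ⟨_, h.ext.linear_mem hℓ fun _ => 1, fun i _ => ?_⟩
  have := h.centered ℓ hℓ c hc i 1
  rw [pow_one, Nat.cast_one] at this
  exact (le_or_gt (2 * i + 1) (c + n)).imp this.1 this.2

theorem exists_notMem_of_finite [CharZero k] {s : Set k} (hs : s.Finite) : ∃ t, t ∉ s := by
  have := CharZero.infinite k
  exact hs.infinite_compl.nonempty

theorem IsSquareExtensionModel.exists_weakLefschetz [CharZero k]
    (h : IsSquareExtensionModel 𝒜 ℬ φ x) (hwlp : HasWLP ℬ) :
    ∃ ℓ ∈ 𝒜 1, ∃ c : Fin n → k, (∀ m, c m ≠ 0) ∧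
      ∀ i : ℤ, 0 ≤ i → MulFullRank (ℬ i) (ℬ (i + 1)) (φ ℓ + ∑ m, c m • x m) := by
  obtain ⟨a, ha, hrank⟩ := hwlp
  obtain ⟨ℓ, hℓ, c, rfl⟩ := h.degree_one a ha
  have hfin := h.std.finite_not_weakLefschetz ha (sum_mem fun m _ => h.ext.x_mem m)
    (b := ∑ m, x m) (t₀ := 0) (by simpa using hrank)
  obtain ⟨t, ht⟩ := exists_notMem_of_finite (hfin.union (Set.finite_range fun m => -c m))
  rw [Set.mem_union, not_or, Set.mem_ofPred_eq, not_not] at ht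
  refine ⟨ℓ, hℓ, fun m => c m + t, fun m hm => ht.2 ⟨m, (eq_neg_of_add_eq_zero_right hm).symm⟩, ?_⟩
  simpa only [add_smul, Finset.sum_add_distrib, Finset.smul_sum, add_assoc] using ht.1

theorem IsSquareExtensionModel.injUpTo_or_surjUpTo (h : IsSquareExtensionModel 𝒜 ℬ φ x)
    {ℓ : B} (hℓ : ℓ ∈ 𝒜 1) {c : Fin n → k} (hc : ∀ m, c m ≠ 0)
    (hrank : ∀ i : ℤ, 0 ≤ i → MulFullRank (ℬ i) (ℬ (i + 1)) (φ ℓ + ∑ m, c m • x m))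
    {σ u : ℤ} (hσ : σ + n = 2 * u + 1) :
    InjUpTo 𝒜 ℓ σ (1 + n) ∨ SurjUpTo 𝒜 ℓ σ (1 + n) := by
  have hfull : MulFullRank (ℬ u) (ℬ (u + 1)) (φ ℓ + ∑ m, c m • x m) := by
    rcases lt_or_ge u 0 with hu | hu
    · exact Or.inl (mulInjOn_of_eq_bot (h.std.neg_bot u hu) _)
    · exact hrank u hu
  refine hfull.imp (fun H => h.injUpTo ℓ hℓ c hc σ 1 le_rfl ?_)
    fun H => h.surjUpTo ℓ hℓ c hc σ 1 le_rfl ?_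
  all_goals
    intro i r h1 h2 _ hir
    obtain rfl : r = 1 := by omega
    obtain rfl : i = u := by omega
    simpa using H

theorem IsStdGradedArtinian.forall_of_injUpTo_or_surjUpTo (h : IsStdGradedArtinian k B 𝒜)
    {ℓ : B} {D : ℕ} (hD : ∀ j : ℤ, D ≤ j → 𝒜 j = ⊥)
    (heven : ∀ σ u : ℤ, σ + (2 * D : ℕ) = 2 * u + 1 →
      InjUpTo 𝒜 ℓ σ (1 + 2 * D) ∨ SurjUpTo 𝒜 ℓ σ (1 + 2 * D))
    (hodd : ∀ σ u : ℤ, σ + (2 * D + 1 : ℕ) = 2 * u + 1 →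
      InjUpTo 𝒜 ℓ σ (1 + (2 * D + 1)) ∨ SurjUpTo 𝒜 ℓ σ (1 + (2 * D + 1))) (σ : ℤ) :
    (∀ (i : ℤ) (r : ℕ), 2 * i + r = σ → MulInjOn (𝒜 i) (ℓ ^ r)) ∨
      (∀ (i : ℤ) (r : ℕ), 2 * i + r = σ → MulSurjOnto (𝒜 i) (𝒜 (i + r)) (ℓ ^ r)) := by
  rcases lt_or_ge σ 0 with hneg | hneg
  · exact Or.inl fun i r hir => mulInjOn_of_eq_bot (h.neg_bot i (by omega)) _
  rcases lt_or_ge (2 * D : ℤ) σ with hbig | hbig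
  · exact Or.inr fun i r hir => mulSurjOnto_of_eq_bot (hD _ (by omega)) _
  obtain ⟨N, hN, hσN, hor⟩ : ∃ N : ℕ, 2 * D ≤ N ∧ (σ - N) % 2 = 0 ∧
      (InjUpTo 𝒜 ℓ σ N ∨ SurjUpTo 𝒜 ℓ σ N) := by
    obtain ⟨u, rfl | rfl⟩ := Int.even_or_odd' σ
    · exact ⟨_, by omega, by omega, hodd _ (u + D) (by push_cast; ring)⟩
    · exact ⟨_, by omega, by omega, heven _ (u + D) (by push_cast; ring)⟩
  refine hor.imp (fun H i r hir => ?_) fun H i r hir => ?_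
  · rcases Nat.eq_zero_or_pos r with rfl | hr
    · exact fun v _ hv => by simpa using hv
    rcases lt_or_ge i 0 with hi | hi
    · exact mulInjOn_of_eq_bot (h.neg_bot i hi) _
    · exact H i r hr (by omega) (by omega) hir
  · rcases Nat.eq_zero_or_pos r with rfl | hr
    · exact fun w hw => ⟨w, by simpa using hw, by simp⟩
    rcases le_or_gt (D : ℤ) (i + r) with hi | hi
    · exact mulSurjOnto_of_eq_bot (hD _ hi) _
    · exact H i r hr (by omega) (by omega) hir

/-- If two models over the same algebra both have the weak Lefschetz property, then weak Lefschetz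
elements of both can be chosen with the same component in the base algebra. -/
theorem IsSquareExtensionModel.exists_common_weakLefschetz [CharZero k]
    (h : IsSquareExtensionModel 𝒜 ℬ φ x) (hwlp : HasWLP ℬ) {A' : Type} [CommRing A'] [Algebra k A']
    {ℬ' : ℤ → Submodule k A'} {n' : ℕ} {φ' : B →ₐ[k] A'} {x' : Fin n' → A'}
    (h' : IsSquareExtensionModel 𝒜 ℬ' φ' x') (hwlp' : HasWLP ℬ') :
    ∃ ℓ ∈ 𝒜 1,
      (∃ c : Fin n → k, (∀ m, c m ≠ 0) ∧
        ∀ i : ℤ, 0 ≤ i → MulFullRank (ℬ i) (ℬ (i + 1)) (φ ℓ + ∑ m, c m • x m)) ∧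
      ∃ c : Fin n' → k, (∀ m, c m ≠ 0) ∧
        ∀ i : ℤ, 0 ≤ i → MulFullRank (ℬ' i) (ℬ' (i + 1)) (φ' ℓ + ∑ m, c m • x' m) := by
  obtain ⟨ℓ, hℓ, c, hc, hrank⟩ := h.exists_weakLefschetz hwlp
  obtain ⟨ℓ', hℓ', c', hc', hrank'⟩ := h'.exists_weakLefschetz hwlp'
  have hsub := sub_mem hℓ' hℓ
  have hfin := h.std.finite_not_weakLefschetz (h.ext.linear_mem hℓ c) (h.ext.map_mem 1 _ hsub)
    (t₀ := 0) (by simpa using hrank)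
  have hfin' := h'.std.finite_not_weakLefschetz (h'.ext.linear_mem hℓ c')
    (h'.ext.map_mem 1 _ hsub) (t₀ := 1) (by
      simpa only [one_smul, map_sub, add_sub_assoc, add_right_comm _ _ (φ' ℓ' - φ' ℓ),
        add_sub_cancel] using hrank')
  obtain ⟨t, ht⟩ := exists_notMem_of_finite (hfin.union hfin')
  simp only [Set.mem_union, not_or, Set.mem_ofPred_eq, not_not] at ht
  refine ⟨ℓ + t • (ℓ' - ℓ), add_mem hℓ (Submodule.smul_mem _ _ hsub), ⟨c, hc, ?_⟩, c', hc', ?_⟩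
  · simpa only [map_add, map_smul, add_right_comm _ (t • φ (ℓ' - ℓ))] using ht.1
  · simpa only [map_add, map_smul, add_right_comm _ (t • φ' (ℓ' - ℓ))] using ht.2

end Main

/-- Over a field `k` of characteristic zero, a standard graded artinian
`k`-algebra `A` is such that `A ⊗ₖ k[x₁,…,xₙ]/(x₁²,…,xₙ²)` has the weak Lefschetz property
for every `n ≥ 0` (with `n = 0` meaning `A` itself) if and only if `A` is almost centered
and has the strong Lefschetz property. -/
theorem statement_18 {k B : Type} [Field k] [CharZero k]
    [CommRing B] [Algebra k B]
    (𝒜 : ℤ → Submodule k B) (hB : IsStdGradedArtinian k B 𝒜) :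
    (∀ (n : ℕ),
      ∀ (A : Type) [CommRing A] [Algebra k A],
        ∀ (ℬ : ℤ → Submodule k A) (φ : B →ₐ[k] A) (x : Fin n → A),
          IsStdGradedArtinian k A ℬ →
          IsMultiCIExtension 𝒜 ℬ φ x (fun _ => 2) → HasWLP ℬ) ↔
      (AlmostCentered 𝒜 ∧ HasSLP 𝒜) := by
  constructor
  · intro H
    obtain ⟨D, hD⟩ := hB.exists_bound
    obtain ⟨A, _, _, ℬ, φ, x, hA⟩ := hB.exists_isSquareExtensionModel (2 * D)
    obtain ⟨A', _, _, ℬ', φ', x', hA'⟩ := hB.exists_isSquareExtensionModel (2 * D + 1)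
    obtain ⟨ℓ, hℓ, ⟨c, hc, hrank⟩, c', hc', hrank'⟩ := hA.exists_common_weakLefschetz
      (H _ _ _ _ _ hA.std hA.ext) hA' (H _ _ _ _ _ hA'.std hA'.ext)
    obtain ⟨d, hd⟩ := hB.exists_isCenteredLefschetz_of_forall hℓ
      (hB.forall_of_injUpTo_or_surjUpTo hD
        (fun _ _ hσ => hA.injUpTo_or_surjUpTo hℓ hc hrank hσ)
        fun _ _ hσ => hA'.injUpTo_or_surjUpTo hℓ hc' hrank' hσ)
    exact ⟨hd.almostCentered hB hℓ, hd.hasSLP hℓ⟩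
  · rintro ⟨hac, hslp⟩ n A _ _ ℬ φ x hA hext
    obtain ⟨ℓ, hℓ, c, hc⟩ := hB.exists_isCenteredLefschetz hac hslp
    obtain ⟨A', _, _, ℬ', φ', x', hA'⟩ := hB.exists_isSquareExtensionModel n
    obtain ⟨ψ, hψφ, hψx⟩ := hA'.exists_lift A φ x hext.x_pow
    exact hA'.ext.hasWLP_of_algHom hA'.std hext ψ hψφ hψx (hA'.hasWLP hℓ hc)
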